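/- Fix an arbitrary instruction field and a configuration η : ℤ^d → ℕ_ρ. If α and β are both legal toppling sequences for η with m_α = m_β, then Φ_α η = Φ_β η. (Local abelianness of the Diaconis–Fulton representation.) -/

import Mathlib

/-!
Site-wise (Diaconis–Fulton) representation of Activated Random Walks on ℤ^d,
and the local abelianness property.
-/

namespace ARW

/-- Sites of the lattice `ℤ^d`. -/
abbrev Site (d : ℕ) := Fin d → ℤ

/-- The set `ℕ_ρ = {0, ρ, 1, 2, 3, …}`: `rho` stands for one passive (sleeping)
particle, `of n` stands for `n` active particles. -/
inductive NatRho where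
  | rho : NatRho
  | of (n : ℕ) : NatRho
deriving DecidableEq

/-- A configuration of the ARW. -/
abbrev Config (d : ℕ) := Site d → NatRho

/-- An instruction: `some y` means "jump by `y`", `none` means "try to sleep" (ρ). -/
abbrev Instr (d : ℕ) := Option (Site d)

/-- An instruction field `I = (I^{x,j})`, the `j`-th instruction at site `x`
(instructions are indexed from `0`). -/
abbrev Field (d : ℕ) := Site d → ℕ → Instr d

/-- Effect, at the target site, of an arriving particle: a passive particle is
activated (ρ becomes 2), otherwise the number of active particles increases by one. -/
def addP : NatRho → NatRho
  | .rho => .of 2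
  | .of n => .of (n + 1)

/-- Effect, at the source site, of a departing active particle. -/
def remP : NatRho → NatRho
  | .rho => .rho
  | .of n => .of (n - 1)

/-- Effect of a sleep instruction ρ: a single active particle falls asleep;
otherwise nothing changes. -/
def sleepy : NatRho → NatRho
  | .of 1 => .rho
  | s => s

/-- A site is unstable when it carries at least one active particle. -/
def IsUnstable {d : ℕ} (η : Config d) (x : Site d) : Prop :=
  ∃ n : ℕ, η x = .of (n + 1)

/-- A state: configuration together with the counter `h` of used instructions. -/
abbrev State (d : ℕ) := Config d × (Site d → ℕ)

/-- Toppling of the site `x`: consume the next unused instruction at `x` and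
perform it, incrementing the counter at `x`. -/
def topple {d : ℕ} (I : Field d) (x : Site d) (s : State d) : State d :=
  let η := s.1
  let h := s.2
  let h' := Function.update h x (h x + 1)
  match I x (h x) with
  | none => (Function.update η x (sleepy (η x)), h')
  | some y =>
      let η₁ := Function.update η x (remP (η x))
      (Function.update η₁ (x + y) (addP (η₁ (x + y))), h')

/-- Performing a finite sequence of topplings in order. -/
def toppleSeq {d : ℕ} (I : Field d) (α : List (Site d)) (s : State d) : State d :=
  α.foldl (fun s x => topple I x s) s

/-- A sequence of topplings is legal when each successive toppled site is
unstable at the moment it is toppled. -/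
def IsLegal {d : ℕ} (I : Field d) : List (Site d) → State d → Prop
  | [], _ => True
  | x :: rest, s => IsUnstable s.1 x ∧ IsLegal I rest (topple I x s)

/-- `Phi I α η` is the configuration `Φ_α η` obtained from `η` by toppling the
sites of `α` in order, starting with the counter `h ≡ 0`. -/
def Phi {d : ℕ} (I : Field d) (α : List (Site d)) (η : Config d) : Config d :=
  (toppleSeq I α (η, fun _ => 0)).1

end ARW

open ARW

namespace ARW

variable {d : ℕ} {I : Field d} {s : State d} {x z : Site d}

lemma IsUnstable.topple_of_ne (hx : IsUnstable s.1 x) (hxz : x ≠ z) :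
    IsUnstable (topple I z s).1 x := by
  obtain ⟨n, hn⟩ := hx
  unfold IsUnstable topple
  cases hIz : I z (s.2 z) with
  | none => exact ⟨n, by simp [hIz, hxz, hn]⟩
  | some y =>
    by_cases hy : x = z + y
    · exact ⟨n + 1, by simp [hIz, ← hy, hxz, hn, addP]⟩
    · exact ⟨n, by simp [hIz, hy, hxz, hn]⟩

/-- Topplings at two distinct unstable sites commute. -/
lemma topple_comm (hx : IsUnstable s.1 x) (hz : IsUnstable s.1 z) (hxz : x ≠ z) :
    topple I x (topple I z s) = topple I z (topple I x s) := by
  obtain ⟨n, hn⟩ := hx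
  obtain ⟨m, hm⟩ := hz
  have hrem (k : ℕ) : addP (remP (.of (k + 1))) = remP (addP (.of (k + 1))) := by
    simp [addP, remP]
  have hsleep (k : ℕ) : addP (sleepy (.of (k + 1))) = sleepy (addP (.of (k + 1))) := by
    cases k <;> simp [addP, sleepy]
  unfold topple
  cases hIx : I x (s.2 x) with
  | none =>
    cases hIz : I z (s.2 z) with
    | none =>
      simp only [Function.update_of_ne hxz, Function.update_of_ne hxz.symm, hIx, hIz]
      exact Prod.ext (Function.update_comm hxz.symm ..) (Function.update_comm hxz.symm ..)
    | some q =>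
      simp only [Function.update_of_ne hxz, Function.update_of_ne hxz.symm, hIx, hIz]
      refine Prod.ext ?_ (Function.update_comm hxz.symm ..)
      funext w
      generalize z + q = q
      simp only [Function.update_apply]
      grind
  | some p =>
    cases hIz : I z (s.2 z) with
    | none =>
      simp only [Function.update_of_ne hxz, Function.update_of_ne hxz.symm, hIx, hIz]
      refine Prod.ext ?_ (Function.update_comm hxz.symm ..)
      funext w
      generalize x + p = p
      simp only [Function.update_apply]
      grind
    | some q =>
      simp only [Function.update_of_ne hxz, Function.update_of_ne hxz.symm, hIx, hIz]
      refine Prod.ext ?_ (Function.update_comm hxz.symm ..)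
      funext w
      generalize x + p = p
      generalize z + q = q
      simp only [Function.update_apply]
      grind

/-- The first toppling of an unstable site can be moved to the front of a legal sequence. -/
lemma IsLegal.move_to_front {β γ : List (Site d)} (hx : IsUnstable s.1 x) (hxβ : x ∉ β)
    (h : IsLegal I (β ++ x :: γ) s) :
    IsLegal I (β ++ γ) (topple I x s) ∧
      toppleSeq I (β ++ γ) (topple I x s) = toppleSeq I (β ++ x :: γ) s := by
  induction β generalizing s with
  | nil => exact ⟨h.2, rfl⟩
  | cons z β ih =>
    rw [List.mem_cons, not_or] at hxβ
    obtain ⟨hz, hrest⟩ := h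
    have hcomm := topple_comm (I := I) hx hz hxβ.1
    have := ih (hx.topple_of_ne hxβ.1) hxβ.2 hrest
    rw [hcomm] at this
    exact ⟨⟨hz.topple_of_ne (Ne.symm hxβ.1), this.1⟩, this.2⟩

/-- Legal sequences that are permutations of each other have the same effect, from any state. -/
lemma toppleSeq_eq_of_perm {α β : List (Site d)} (hα : IsLegal I α s) (hβ : IsLegal I β s)
    (hperm : α.Perm β) : toppleSeq I α s = toppleSeq I β s := by
  induction α generalizing s β with
  | nil => rw [hperm.nil_eq]
  | cons x α ih =>
    obtain ⟨β₁, β₂, rfl, hxβ₁⟩ :=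
      List.eq_append_cons_of_mem (hperm.subset List.mem_cons_self)
    obtain ⟨hlegal, heq⟩ := hβ.move_to_front hα.1 hxβ₁
    rw [← heq]
    exact ih hα.2 hlegal (hperm.trans List.perm_middle).cons_inv

end ARW

/-- **Local abelianness.** For a fixed instruction field, if `α` and `β` are legal
toppling sequences for `η` with `m_α = m_β`, then `Φ_α η = Φ_β η`. -/
theorem local_abelianness {d : ℕ} (I : Field d) (η : Config d)
    (α β : List (Site d))
    (hα : IsLegal I α (η, fun _ => 0)) (hβ : IsLegal I β (η, fun _ => 0))
    (hm : ∀ x : Site d, α.count x = β.count x) :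
    Phi I α η = Phi I β η := by
  exact congrArg Prod.fst (toppleSeq_eq_of_perm hα hβ (List.perm_iff_count.mpr hm))
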